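/- arXiv:2212.03571 — 2 statements merged into one kernel-verified Lean document; each statement's English description precedes it below -/
import Mathlib

section
/- Let G be a connected finite simple graph on at least 2 vertices and let y be a Fiedler vector of G. If y(i) > 0 for a vertex i, then there exists a vertex j adjacent to i with y(j) < y(i). -/
open Matrix Finset Filter

/-- The Laplacian quadratic form `xᵀ L(G) x`. -/
noncomputable def lapQ {V : Type*} [Fintype V] (G : SimpleGraph V) (x : V → ℝ) : ℝ :=
  letI := Classical.decEq V
  letI : DecidableRel G.Adj := Classical.decRel _
  x ⬝ᵥ (G.lapMatrix ℝ *ᵥ x)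

/-- The Laplacian matrix of `G` over `ℝ` (classical decidability). -/
noncomputable def lapMat {V : Type*} [Fintype V] (G : SimpleGraph V) : Matrix V V ℝ :=
  letI := Classical.decEq V
  letI : DecidableRel G.Adj := Classical.decRel _
  G.lapMatrix ℝ

/-- The algebraic connectivity `μ(G)`: the infimum of Rayleigh quotients of the Laplacian
over nonzero vectors orthogonal to the all-ones vector. -/
noncomputable def algConn {V : Type*} [Fintype V] (G : SimpleGraph V) : ℝ :=
  sInf {r : ℝ | ∃ x : V → ℝ, x ≠ 0 ∧ (∑ v, x v) = 0 ∧ r = lapQ G x / (∑ v, (x v) ^ 2)}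

lemma lapQ_pos {V : Type*} [Fintype V] (G : SimpleGraph V) (hconn : G.Connected)
    {x : V → ℝ} (hx : x ≠ 0) (hsum : ∑ v, x v = 0) : 0 < lapQ G x := by
  classical
  have hform : lapQ G x = toLinearMap₂' ℝ (G.lapMatrix ℝ) x x := by
    rw [toLinearMap₂'_apply']
    unfold lapQ
    congr!
  rw [hform]
  refine lt_of_le_of_ne ?_ fun h0 => hx ?_
  · rw [SimpleGraph.lapMatrix_toLinearMap₂']
    positivity
  · have hreach := (G.lapMatrix_toLinearMap₂'_apply'_eq_zero_iff_forall_reachable x).1 h0.symm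
    funext i
    have hconst : ∑ v, x v = ∑ _v : V, x i :=
      Finset.sum_congr rfl fun v _ => hreach v i (hconn.preconnected v i)
    rw [hsum, Finset.sum_const, nsmul_eq_mul, Finset.card_univ] at hconst
    have := hconn.nonempty
    have hcard : (Fintype.card V : ℝ) ≠ 0 := by exact_mod_cast Fintype.card_ne_zero
    simpa [hcard] using hconst.symm

lemma continuous_lapQ {V : Type*} [Fintype V] (G : SimpleGraph V) : Continuous (lapQ G) := by
  unfold lapQ
  fun_prop

lemma lapQ_smul {V : Type*} [Fintype V] (G : SimpleGraph V) (c : ℝ) (x : V → ℝ) :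
    lapQ G (c • x) = c ^ 2 * lapQ G x := by
  simp only [lapQ, mulVec_smul, smul_dotProduct, dotProduct_smul, smul_eq_mul]
  ring

lemma isCompact_unit_sum_zero (V : Type*) [Fintype V] :
    IsCompact {x : V → ℝ | ∑ v, x v = 0 ∧ ∑ v, x v ^ 2 = 1} := by
  refine Metric.isCompact_of_isClosed_isBounded ?_ ?_
  · exact (isClosed_eq (by fun_prop) continuous_const).inter
      (isClosed_eq (by fun_prop) continuous_const)
  · refine (Metric.isBounded_closedBall (x := (0 : V → ℝ)) (r := 1)).subset fun x hx => ?_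
    rw [mem_closedBall_zero_iff, pi_norm_le_iff_of_nonneg zero_le_one]
    intro i
    rw [Real.norm_eq_abs, ← sq_le_one_iff_abs_le_one, ← hx.2]
    exact Finset.single_le_sum (f := fun v => x v ^ 2) (fun v _ => sq_nonneg _) (mem_univ i)

lemma sum_sq_pos {V : Type*} [Fintype V] {x : V → ℝ} (hx : x ≠ 0) : 0 < ∑ v, x v ^ 2 := by
  obtain ⟨i, hi⟩ := Function.ne_iff.1 hx
  exact Finset.sum_pos' (fun v _ => sq_nonneg _) ⟨i, mem_univ i, sq_pos_of_ne_zero hi⟩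

lemma exists_ne_zero_sum_eq_zero {V : Type*} [Fintype V] (hcard : 2 ≤ Fintype.card V) :
    ∃ x : V → ℝ, x ≠ 0 ∧ ∑ v, x v = 0 := by
  classical
  obtain ⟨a, b, hab⟩ := Fintype.exists_pair_of_one_lt_card hcard
  refine ⟨Pi.single a 1 - Pi.single b 1, fun h => ?_, by simp [Finset.sum_sub_distrib]⟩
  simpa [hab] using congrFun h a

lemma algConn_pos {V : Type*} [Fintype V] (G : SimpleGraph V) (hconn : G.Connected)
    (hcard : 2 ≤ Fintype.card V) : 0 < algConn G := by
  have hnormalize : ∀ x : V → ℝ, x ≠ 0 → ∑ v, x v = 0 →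
      (√(∑ v, x v ^ 2))⁻¹ • x ∈ {x : V → ℝ | ∑ v, x v = 0 ∧ ∑ v, x v ^ 2 = 1} := by
    intro x hx hsum
    have hpos := sum_sq_pos hx
    constructor
    · simp [← Finset.mul_sum, hsum]
    · simp only [Pi.smul_apply, smul_eq_mul, mul_pow, ← Finset.mul_sum, inv_pow,
        Real.sq_sqrt hpos.le]
      exact inv_mul_cancel₀ hpos.ne'
  obtain ⟨x₀, hx₀, hsum₀⟩ := exists_ne_zero_sum_eq_zero hcard
  obtain ⟨z, hz, hmin⟩ := (isCompact_unit_sum_zero V).exists_isMinOn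
    ⟨_, hnormalize x₀ hx₀ hsum₀⟩ (continuous_lapQ G).continuousOn
  have hz0 : z ≠ 0 := by
    rintro rfl
    simpa using hz.2
  refine (lapQ_pos G hconn hz0 hz.1).trans_le (le_csInf ⟨_, x₀, hx₀, hsum₀, rfl⟩ ?_)
  rintro _ ⟨x, hx, hsum, rfl⟩
  have hle : lapQ G z ≤ lapQ G ((√(∑ v, x v ^ 2))⁻¹ • x) := hmin (hnormalize x hx hsum)
  rwa [lapQ_smul, inv_pow, Real.sq_sqrt (sum_sq_pos hx).le, ← div_eq_inv_mul] at hle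

lemma lapMat_mulVec_apply {V : Type*} [Fintype V] (G : SimpleGraph V) [DecidableRel G.Adj]
    (y : V → ℝ) (i : V) :
    (lapMat G *ᵥ y) i = ∑ j ∈ G.neighborFinset i, (y i - y j) := by
  classical
  have hlap : lapMat G = G.lapMatrix ℝ := by
    unfold lapMat
    congr!
  rw [hlap, SimpleGraph.lapMatrix_mulVec_apply, Finset.sum_sub_distrib, Finset.sum_const,
    SimpleGraph.card_neighborFinset_eq_degree, nsmul_eq_mul]

/-- Fiedler: if `y` is a Fiedler vector of a connected graph `G` on at least
two vertices and `y(i) > 0`, then some neighbor `j` of `i` has `y(j) < y(i)`. -/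
theorem statement7 {V : Type*} [Fintype V] (G : SimpleGraph V) (hconn : G.Connected)
    (hcard : 2 ≤ Fintype.card V) (y : V → ℝ) (hy : y ≠ 0)
    (heig : lapMat G *ᵥ y = algConn G • y) (i : V) (hi : 0 < y i) :
    ∃ j, G.Adj i j ∧ y j < y i := by
  classical
  have hpos : 0 < ∑ j ∈ G.neighborFinset i, (y i - y j) := by
    rw [← lapMat_mulVec_apply, heig]
    exact mul_pos (algConn_pos G hconn hcard) hi
  obtain ⟨j, hj, hlt⟩ := Finset.exists_lt_of_sum_lt
    (f := fun _ => (0 : ℝ)) (Finset.sum_const_zero.trans_lt hpos)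
  exact ⟨j, (G.mem_neighborFinset i j).1 hj, sub_pos.1 hlt⟩
end

section
/- For every integer d ≥ 3 there exists a constant c ≥ 0 such that for every ε > 0 there exists N with the following property: for every n ≥ N divisible by d+1, there exists a connected simple graph G on n vertices with minimum degree exactly d, diam(G) ≥ 3n/(d+1) − c, and μ(G) ≤ (1+ε)·(d−1)·π²/n². -/
open Matrix Finset Filter

section Transport

variable {V W : Type*} [Fintype V] [Fintype W]

lemma lapQ_eq_sum_adj (G : SimpleGraph V) [DecidableRel G.Adj] (x : V → ℝ) :
    lapQ G x = (∑ a, ∑ b, if G.Adj a b then (x a - x b) ^ 2 else 0) / 2 := by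
  classical
  have h := G.lapMatrix_toLinearMap₂' ℝ x
  rw [toLinearMap₂'_apply'] at h
  rw [← h]
  unfold lapQ
  congr!

lemma lapQ_nonneg (G : SimpleGraph V) (x : V → ℝ) : 0 ≤ lapQ G x := by
  classical
  rw [lapQ_eq_sum_adj]
  positivity

lemma lapQ_comap (e : V ≃ W) (G : SimpleGraph W) (x : W → ℝ) :
    lapQ (G.comap e) (x ∘ e) = lapQ G x := by
  classical
  rw [lapQ_eq_sum_adj, lapQ_eq_sum_adj, ← e.sum_comp]
  congr 1
  refine Finset.sum_congr rfl fun a _ => ?_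
  rw [← e.sum_comp]
  simp

lemma algConn_le_rayleigh (G : SimpleGraph V) (x : V → ℝ) (hx : x ≠ 0) (hsum : ∑ v, x v = 0) :
    algConn G ≤ lapQ G x / ∑ v, x v ^ 2 := by
  refine csInf_le ⟨0, ?_⟩ ⟨x, hx, hsum, rfl⟩
  rintro r ⟨y, -, -, rfl⟩
  exact div_nonneg (lapQ_nonneg G y) (Finset.sum_nonneg fun _ _ => sq_nonneg _)

lemma algConn_comap_le_rayleigh (e : V ≃ W) (G : SimpleGraph W) (x : W → ℝ)
    (hpos : 0 < ∑ w, x w ^ 2) (hsum : ∑ w, x w = 0) :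
    algConn (G.comap e) ≤ lapQ G x / ∑ w, x w ^ 2 := by
  have hsq : ∑ v, (x ∘ e) v ^ 2 = ∑ w, x w ^ 2 := e.sum_comp fun w => x w ^ 2
  have h := algConn_le_rayleigh (G.comap e) (x ∘ e) ?_ ?_
  · rwa [lapQ_comap, hsq] at h
  · intro h0
    rw [← hsq, h0] at hpos
    simp at hpos
  · rw [← hsum]
    exact e.sum_comp x

lemma ncard_neighborSet_comap {V W : Type*} (e : V ≃ W) (G : SimpleGraph W) (v : V) :
    ((G.comap e).neighborSet v).ncard = (G.neighborSet (e v)).ncard :=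
  Set.ncard_preimage_of_injective_subset_range e.injective
    (by rw [e.surjective.range_eq]; exact Set.subset_univ _)

end Transport

lemma SimpleGraph.Connected.le_add_dist {V : Type*} {G : SimpleGraph V} (hG : G.Connected)
    (h : V → ℕ) (hh : ∀ u v, G.Adj u v → h v ≤ h u + 1) (u v : V) :
    h v ≤ h u + G.dist u v := by
  obtain ⟨p, hp⟩ := hG.exists_walk_length_eq_dist u v
  rw [← hp]
  clear hp
  induction p with
  | nil => simp
  | cons hadj p ih =>
    have := hh _ _ hadj
    rw [SimpleGraph.Walk.length_cons]
    omega

section Trigonometry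

open Real

lemma cos_sub_cos_sq_le (a b : ℝ) :
    (cos a - cos b) ^ 2 ≤ sin ((a + b) / 2) ^ 2 * (a - b) ^ 2 := by
  rw [cos_sub_cos]
  have h : sin ((a - b) / 2) ^ 2 ≤ ((a - b) / 2) ^ 2 := sq_le_sq.mpr abs_sin_le_abs
  nlinarith [mul_le_mul_of_nonneg_left h (sq_nonneg (sin ((a + b) / 2)))]

lemma sum_cos_two_mul_eq_zero {k : ℕ} (hk : 2 ≤ k) (c : ℝ) :
    ∑ i ∈ range k, cos (2 * (π / k * (i + c))) = 0 := by
  have hk' : (2 : ℝ) ≤ k := by exact_mod_cast hk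
  have hpos : 0 < sin (π / k) := by
    refine sin_pos_of_pos_of_lt_pi (by positivity) ?_
    rw [div_lt_iff₀ (by linarith)]
    nlinarith [pi_pos]
  have htel : ∀ i : ℕ, 2 * sin (π / k) * cos (2 * (π / k * (i + c))) =
      sin (2 * (π / k * ((i + 1 : ℕ) + c)) - π / k) - sin (2 * (π / k * (i + c)) - π / k) := by
    intro i
    rw [sin_sub_sin]
    push_cast
    congr 2
    · congr 1; ring
    · ring
  have hsum : 2 * sin (π / k) * ∑ i ∈ range k, cos (2 * (π / k * (i + c))) = 0 := by
    rw [Finset.mul_sum, Finset.sum_congr rfl fun i _ => htel i,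
      Finset.sum_range_sub fun i : ℕ => sin (2 * (π / k * (i + c)) - π / k), sub_eq_zero]
    have : 2 * (π / k * ((k : ℝ) + c)) - π / k
        = 2 * (π / k * ((0 : ℕ) + c)) - π / k + 2 * π := by
      push_cast
      field_simp
      ring
    rw [this, sin_add_two_pi]
  rcases mul_eq_zero.mp hsum with h | h
  · linarith
  · exact h

lemma sum_sin_sq_eq {k : ℕ} (hk : 2 ≤ k) (c : ℝ) :
    ∑ i : Fin k, sin (π / k * (i + c)) ^ 2 = k / 2 := by
  rw [Fin.sum_univ_eq_sum_range fun i : ℕ => sin (π / k * (i + c)) ^ 2]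
  simp_rw [sin_sq_eq_half_sub]
  rw [Finset.sum_sub_distrib, ← Finset.sum_div _ fun i : ℕ => cos (2 * (π / k * (i + c))),
    sum_cos_two_mul_eq_zero hk]
  simp
  ring

lemma sum_cos_sq_eq {k : ℕ} (hk : 2 ≤ k) (c : ℝ) :
    ∑ i : Fin k, cos (π / k * (i + c)) ^ 2 = k / 2 := by
  simp_rw [cos_sq', Finset.sum_sub_distrib, sum_sin_sq_eq hk]
  simp
  ring

lemma sum_cos_add_reflect {k : ℕ} (c : ℝ) :
    ∑ i : Fin k, cos (π / k * (i + 1 / 2 + c)) = -∑ i : Fin k, cos (π / k * (i + 1 / 2 - c)) := by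
  rw [← Equiv.sum_comp Fin.revPerm, ← Finset.sum_neg_distrib]
  refine Finset.sum_congr rfl fun i _ => ?_
  rw [← cos_pi_sub, Fin.revPerm_apply, Fin.val_rev, Nat.cast_sub i.isLt]
  have : (k : ℝ) ≠ 0 := by have := i.pos; positivity
  congr 1
  push_cast
  field_simp
  ring

end Trigonometry

lemma sum_ite_le_of_subsingleton {ι : Type*} [Fintype ι] (p : ι → Prop) [DecidablePred p]
    (hp : ∀ i j, p i → p j → i = j) {C : ℝ} (hC : 0 ≤ C) : (∑ i, if p i then C else 0) ≤ C := by
  rw [← Finset.sum_filter, Finset.sum_const, nsmul_eq_mul]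
  have h : (Finset.univ.filter p).card ≤ 1 :=
    Finset.card_le_one.mpr fun i hi j hj => hp i j (by simpa using hi) (by simpa using hj)
  have : ((Finset.univ.filter p).card : ℝ) ≤ 1 := by exact_mod_cast h
  nlinarith

/-- Vertices of a necklace of `k` beads: each bead has a left end `inl false`, a right end
`inl true` and `m` middle vertices. -/
abbrev NecklaceVertex (k m : ℕ) : Type := Fin k × (Bool ⊕ Fin m)

/-- An orientation of the edges of the necklace (edges between middle vertices carry both
orientations): middle vertices are joined to their whole bead, the ends of the first and of the
last bead are joined to each other, and consecutive beads are linked by a bridge. -/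
def necklaceRel (k m : ℕ) (u v : NecklaceVertex k m) : Prop :=
  (u.1 = v.1 ∧ (u.2.isRight ∨
    (u.2 = .inl false ∧ v.2 = .inl true ∧ ((u.1 : ℕ) = 0 ∨ (u.1 : ℕ) + 1 = k)))) ∨
  ((u.1 : ℕ) + 1 = v.1 ∧ u.2 = .inl true ∧ v.2 = .inl false)

instance (k m : ℕ) : DecidableRel (necklaceRel k m) := fun _ _ => by
  unfold necklaceRel; infer_instance

/-- A chain of `k` cliques on `m + 2` vertices, each inner one with an edge removed, linked by
bridges between the ends of removed edges. -/
def necklace (k m : ℕ) : SimpleGraph (NecklaceVertex k m) := SimpleGraph.fromRel (necklaceRel k m)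

lemma necklace_adj_iff {k m : ℕ} {u v : NecklaceVertex k m} :
    (necklace k m).Adj u v ↔ u ≠ v ∧ (necklaceRel k m u v ∨ necklaceRel k m v u) := Iff.rfl

lemma necklace_adj_middle {k m : ℕ} (i : Fin k) (j : Fin m) (t : Bool ⊕ Fin m) (ht : t ≠ .inr j) :
    (necklace k m).Adj (i, .inr j) (i, t) := by
  refine necklace_adj_iff.mpr ⟨?_, Or.inl (Or.inl ⟨rfl, Or.inl rfl⟩)⟩
  simpa using ht.symm

lemma necklace_adj_bridge {k m : ℕ} (i j : Fin k) (h : (i : ℕ) + 1 = j) :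
    (necklace k m).Adj (i, .inl true) (j, .inl false) :=
  necklace_adj_iff.mpr ⟨by simp, Or.inl (Or.inr ⟨h, rfl, rfl⟩)⟩

lemma necklace_connected {k m : ℕ} (hk : 0 < k) (hm : 0 < m) : (necklace k m).Connected := by
  have hmid : ∀ (i : Fin k) (t : Bool ⊕ Fin m),
      (necklace k m).Reachable (i, .inr ⟨0, hm⟩) (i, t) := by
    intro i t
    by_cases ht : t = .inr ⟨0, hm⟩
    · rw [ht]
    · exact (necklace_adj_middle i _ t ht).reachable
  have hbead : ∀ (i : ℕ) (hi : i < k),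
      (necklace k m).Reachable (⟨0, hk⟩, .inr ⟨0, hm⟩) (⟨i, hi⟩, .inr ⟨0, hm⟩) := by
    intro i
    induction i with
    | zero => intro _; rfl
    | succ i ih =>
      intro hi
      have hi' : i < k := by omega
      exact (ih hi').trans (((hmid ⟨i, hi'⟩ (.inl true)).trans
        (necklace_adj_bridge ⟨i, hi'⟩ ⟨i + 1, hi⟩ rfl).reachable).trans
          (hmid ⟨i + 1, hi⟩ (.inl false)).symm)
  rw [SimpleGraph.connected_iff_exists_forall_reachable]
  exact ⟨_, fun w => (hbead w.1 w.1.isLt).trans (hmid w.1 w.2)⟩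

/-- A 1-Lipschitz potential on the necklace. -/
def necklaceHeight (k m : ℕ) (u : NecklaceVertex k m) : ℕ :=
  3 * u.1 + if u.2 = .inl false ∧ (u.1 : ℕ) ≠ 0 then 0 else
    if u.2 = .inl true ∧ (u.1 : ℕ) + 1 ≠ k then 2 else 1

lemma necklaceHeight_le_of_adj {k m : ℕ} (u v : NecklaceVertex k m)
    (h : (necklace k m).Adj u v) : necklaceHeight k m v ≤ necklaceHeight k m u + 1 := by
  obtain ⟨i, s⟩ := u
  obtain ⟨j, t⟩ := v
  have hi := i.isLt
  have hj := j.isLt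
  obtain ⟨-, h⟩ := necklace_adj_iff.mp h
  simp only [necklaceRel, necklaceHeight, Fin.ext_iff] at h ⊢
  rcases s with (_ | _) | s <;> rcases t with (_ | _) | t <;> simp at h ⊢ <;> try split_ifs
  all_goals omega

lemma le_ncard_of_injOn {α β : Type*} [Fintype α] [DecidableEq α] [Finite β] (a : α) (s : Set β)
    (g : α → β) (hg : Set.InjOn g {a}ᶜ) (hs : ∀ x ≠ a, g x ∈ s) :
    Fintype.card α - 1 ≤ s.ncard := by
  have hsub : g '' {a}ᶜ ⊆ s := by
    rintro _ ⟨x, hx, rfl⟩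
    exact hs x hx
  refine le_trans ?_ (Set.ncard_le_ncard hsub)
  rw [hg.ncard_image, Set.ncard_compl, Set.ncard_singleton, Nat.card_eq_fintype_card]

lemma necklace_le_ncard_neighborSet {k m : ℕ} (v : NecklaceVertex k m) :
    m + 1 ≤ ((necklace k m).neighborSet v).ncard := by
  have hcard : Fintype.card (Bool ⊕ Fin m) - 1 = m + 1 := by simp; omega
  rw [← hcard]
  obtain ⟨i, (_ | _) | j⟩ := v
  · by_cases hi : (i : ℕ) = 0
    · refine le_ncard_of_injOn (.inl false) _ (fun t => (i, t)) (by simp [Set.InjOn]) ?_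
      rintro ((_ | _) | t) ht
      · simp at ht
      · exact necklace_adj_iff.mpr ⟨by simp, by simp [necklaceRel, hi]⟩
      · exact (necklace_adj_middle i t _ (by simp)).symm
    · refine le_ncard_of_injOn (.inl false) _
        (fun t => (if t = .inl true then ⟨i - 1, by omega⟩ else i, t)) ?_ ?_
      · intro a _ b _ hab
        exact (Prod.mk.inj hab).2
      · rintro ((_ | _) | t) ht
        · simp at ht
        · exact (necklace_adj_bridge ⟨i - 1, by omega⟩ i (by simp; omega)).symm
        · exact (necklace_adj_middle i t _ (by simp)).symm
  · by_cases hi : (i : ℕ) + 1 = k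
    · refine le_ncard_of_injOn (.inl true) _ (fun t => (i, t)) (by simp [Set.InjOn]) ?_
      rintro ((_ | _) | t) ht
      · exact necklace_adj_iff.mpr ⟨by simp, by simp [necklaceRel, hi]⟩
      · simp at ht
      · exact (necklace_adj_middle i t _ (by simp)).symm
    · refine le_ncard_of_injOn (.inl true) _
        (fun t => (if t = .inl false then ⟨i + 1, by omega⟩ else i, t)) ?_ ?_
      · intro a _ b _ hab
        exact (Prod.mk.inj hab).2
      · rintro ((_ | _) | t) ht
        · exact necklace_adj_bridge i ⟨i + 1, by omega⟩ rfl
        · simp at ht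
        · exact (necklace_adj_middle i t _ (by simp)).symm
  · refine le_ncard_of_injOn (.inr j) _ (fun t => (i, t)) (by simp [Set.InjOn]) ?_
    intro t ht
    exact necklace_adj_middle i j t ht

lemma necklace_ncard_neighborSet_middle {k m : ℕ} (i : Fin k) (j : Fin m) :
    ((necklace k m).neighborSet (i, .inr j)).ncard = m + 1 := by
  refine le_antisymm ?_ (necklace_le_ncard_neighborSet _)
  have hsub : (necklace k m).neighborSet (i, .inr j) ⊆ (fun t => (i, t)) '' {.inr j}ᶜ := by
    rintro ⟨i', t⟩ h
    obtain ⟨hne, h⟩ := necklace_adj_iff.mp h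
    simp only [necklaceRel] at h
    have hi : i = i' := by
      rcases h with h | h <;> simp at h
      · exact h
      · exact h.1.symm
    subst hi
    refine ⟨t, ?_, rfl⟩
    rintro rfl
    exact hne rfl
  refine (Set.ncard_le_ncard hsub).trans ((Set.ncard_image_le (Set.toFinite _)).trans ?_)
  rw [Set.ncard_compl, Set.ncard_singleton, Nat.card_eq_fintype_card]
  simp
  omega

/-- Horizontal offset of a vertex inside its bead. -/
def beadOffset {m : ℕ} : Bool ⊕ Fin m → ℝ
  | .inl false => -1
  | .inl true => 1
  | .inr _ => 0

lemma lapQ_necklace_le {k m : ℕ} (g : ℕ → ℝ → ℝ) :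
    lapQ (necklace k m) (fun v => g v.1 (beadOffset v.2)) ≤
      ∑ i : Fin k, (m * ((g i 0 - g i (-1)) ^ 2 + (g i 0 - g i 1) ^ 2) +
        (if (i : ℕ) = 0 ∨ (i : ℕ) + 1 = k then (g i (-1) - g i 1) ^ 2 else 0) +
        ∑ j : Fin k, if (i : ℕ) + 1 = j then (g i 1 - g j (-1)) ^ 2 else 0) := by
  classical
  set x : NecklaceVertex k m → ℝ := fun v => g v.1 (beadOffset v.2) with hx
  have horient : lapQ (necklace k m) x ≤
      ∑ a, ∑ b, if necklaceRel k m a b then (x a - x b) ^ 2 else 0 := by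
    rw [lapQ_eq_sum_adj, div_le_iff₀ two_pos, mul_two]
    conv_rhs => arg 2; rw [Finset.sum_comm]
    rw [← Finset.sum_add_distrib]
    refine Finset.sum_le_sum fun a _ => ?_
    rw [← Finset.sum_add_distrib]
    refine Finset.sum_le_sum fun b _ => ?_
    have h1 := sq_nonneg (x a - x b)
    have h2 := sq_nonneg (x b - x a)
    have h3 : (x a - x b) ^ 2 = (x b - x a) ^ 2 := by ring
    simp only [necklace_adj_iff]
    split_ifs <;> first | linarith | (exfalso; tauto)
  refine horient.trans (le_of_eq ?_)
  rw [Fintype.sum_prod_type]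
  refine Finset.sum_congr rfl fun i _ => ?_
  simp [Fintype.sum_prod_type, necklaceRel, hx, beadOffset, Finset.sum_add_distrib, ite_and]
  ring

section TestVector

open Real

/-- The cosine profile along the necklace. -/
noncomputable def cosProfile (k m : ℕ) (i : ℕ) (s : ℝ) : ℝ :=
  cos (π / k * (i + 1 / 2 + s / (m + 2)))

lemma sum_cosProfile_eq_zero (k m : ℕ) :
    ∑ v : NecklaceVertex k m, cosProfile k m v.1 (beadOffset v.2) = 0 := by
  have h1 := sum_cos_add_reflect (k := k) (1 / ((m : ℝ) + 2))
  have h0 := sum_cos_add_reflect (k := k) 0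
  simp only [add_zero, sub_zero] at h0
  rw [Fintype.sum_prod_type_right]
  simp only [Fintype.sum_sum_type, Fintype.sum_bool, beadOffset, cosProfile, neg_div,
    ← sub_eq_add_neg, zero_div, add_zero]
  rw [h1, show ∑ i : Fin k, cos (π / k * (i + 1 / 2)) = 0 by linarith]
  simp

lemma sum_cosProfile_sq {k : ℕ} (hk : 2 ≤ k) (m : ℕ) :
    ∑ v : NecklaceVertex k m, cosProfile k m v.1 (beadOffset v.2) ^ 2 = k * (m + 2) / 2 := by
  rw [Fintype.sum_prod_type_right]
  simp only [cosProfile, add_assoc, sum_cos_sq_eq hk]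
  simp
  ring

lemma cosProfile_sub_sq_le (k m : ℕ) (i j : ℕ) (s t : ℝ) :
    (cosProfile k m i s - cosProfile k m j t) ^ 2 ≤
      sin (π / k * (i + ((j - i + 1) / 2 + (s + t) / (2 * (m + 2))))) ^ 2 *
        (π / k * (i - j + (s - t) / (m + 2))) ^ 2 := by
  refine (cos_sub_cos_sq_le _ _).trans (le_of_eq ?_)
  congr 3
  · field_simp
    ring
  · ring

lemma lapQ_cosProfile_le {k : ℕ} (hk : 2 ≤ k) (m : ℕ) :
    lapQ (necklace k m) (fun v => cosProfile k m v.1 (beadOffset v.2)) ≤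
      (π / k) ^ 2 * (k * m / (2 * (m + 2)) + 8 / (m + 2) ^ 2) := by
  set θ := π / k with hθ
  set δ : ℝ := 1 / (m + 2) with hδ
  have hleft : ∀ i : ℕ, (cosProfile k m i 0 - cosProfile k m i (-1)) ^ 2 ≤
      sin (θ * (i + (1 / 2 - δ / 2))) ^ 2 * (θ * δ) ^ 2 := by
    intro i
    refine (cosProfile_sub_sq_le k m i i 0 (-1)).trans (le_of_eq ?_)
    simp only [hδ, hθ]
    congr 3 <;> field_simp <;> ring
  have hright : ∀ i : ℕ, (cosProfile k m i 0 - cosProfile k m i 1) ^ 2 ≤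
      sin (θ * (i + (1 / 2 + δ / 2))) ^ 2 * (θ * δ) ^ 2 := by
    intro i
    rw [← neg_sq (θ * δ)]
    refine (cosProfile_sub_sq_le k m i i 0 1).trans (le_of_eq ?_)
    simp only [hδ, hθ]
    congr 3 <;> field_simp <;> ring
  have hends : ∀ i : ℕ, (cosProfile k m i (-1) - cosProfile k m i 1) ^ 2 ≤ 4 * (θ * δ) ^ 2 := by
    intro i
    have h := cosProfile_sub_sq_le k m i i (-1) 1
    refine h.trans ?_
    rw [show (π / k * ((i : ℝ) - i + (-1 - 1) / (m + 2))) ^ 2 = 4 * (θ * δ) ^ 2 by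
      rw [hδ, hθ]; ring]
    exact mul_le_of_le_one_left (by positivity) (sin_sq_le_one _)
  have hbridge : ∀ i : ℕ, (cosProfile k m i 1 - cosProfile k m (i + 1) (-1)) ^ 2 ≤
      sin (θ * (i + 1)) ^ 2 * (θ * (m * δ)) ^ 2 := by
    intro i
    rw [← neg_sq (θ * (m * δ))]
    refine (cosProfile_sub_sq_le k m i (i + 1) 1 (-1)).trans (le_of_eq ?_)
    push_cast
    congr 3
    · ring
    · rw [hδ, hθ]; field_simp; ring
  calc _ ≤ _ := lapQ_necklace_le (cosProfile k m)
    _ ≤ ∑ i : Fin k, (m * (sin (θ * (i + (1 / 2 - δ / 2))) ^ 2 * (θ * δ) ^ 2 +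
          sin (θ * (i + (1 / 2 + δ / 2))) ^ 2 * (θ * δ) ^ 2) +
        ((if (i : ℕ) = 0 then 4 * (θ * δ) ^ 2 else 0) +
          (if (i : ℕ) + 1 = k then 4 * (θ * δ) ^ 2 else 0)) +
        sin (θ * (i + 1)) ^ 2 * (θ * (m * δ)) ^ 2) := by
      refine Finset.sum_le_sum fun i _ => ?_
      refine add_le_add (add_le_add ?_ ?_) ?_
      · exact mul_le_mul_of_nonneg_left (add_le_add (hleft i) (hright i)) (by positivity)
      · have := hends i
        have : 0 ≤ 4 * (θ * δ) ^ 2 := by positivity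
        split_ifs <;> first | linarith | (exfalso; tauto)
      · refine le_trans (Finset.sum_le_sum fun j _ => ?_)
          (sum_ite_le_of_subsingleton (fun j : Fin k => (i : ℕ) + 1 = j) ?_ (by positivity))
        · split_ifs with h
          · rw [← h]
            exact hbridge i
          · rfl
        · intro a b ha hb
          exact Fin.ext (by omega)
    _ ≤ m * (k / 2 * (θ * δ) ^ 2 + k / 2 * (θ * δ) ^ 2) +
        (4 * (θ * δ) ^ 2 + 4 * (θ * δ) ^ 2) + k / 2 * (θ * (m * δ)) ^ 2 := by
      simp only [Finset.sum_add_distrib, ← Finset.mul_sum, ← Finset.sum_mul]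
      rw [hθ, sum_sin_sq_eq hk, sum_sin_sq_eq hk, sum_sin_sq_eq hk, ← hθ]
      gcongr
      · refine sum_ite_le_of_subsingleton _ (fun i j hi hj => Fin.ext ?_) (by positivity)
        omega
      · refine sum_ite_le_of_subsingleton _ (fun i j hi hj => Fin.ext ?_) (by positivity)
        omega
    _ = θ ^ 2 * (k * m / (2 * (m + 2)) + 8 / (m + 2) ^ 2) := by
      rw [hδ]
      field_simp
      ring

end TestVector

/-- for every `d ≥ 3` there is a constant `c ≥ 0` such that for every `ε > 0`
there is `N` with: for every `n ≥ N` divisible by `d+1` there exists a connected graph `G`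
on `n` vertices with minimum degree exactly `d`, `diam(G) ≥ 3n/(d+1) − c`, and
`μ(G) ≤ (1+ε)·(d−1)·π²/n²`. -/
theorem statement16 (d : ℕ) (hd : 3 ≤ d) :
    ∃ c : ℝ, 0 ≤ c ∧ ∀ ε : ℝ, 0 < ε → ∃ N : ℕ, ∀ n : ℕ, N ≤ n → (d + 1) ∣ n →
      ∃ G : SimpleGraph (Fin n), G.Connected ∧
        (∀ v, d ≤ (G.neighborSet v).ncard) ∧ (∃ v, (G.neighborSet v).ncard = d) ∧
        3 * (n : ℝ) / ((d : ℝ) + 1) - c ≤ (G.diam : ℝ) ∧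
        algConn G ≤ (1 + ε) * ((d : ℝ) - 1) * Real.pi ^ 2 / (n : ℝ) ^ 2 := by
  obtain ⟨m, rfl⟩ : ∃ m, d = m + 1 := ⟨d - 1, by omega⟩
  refine ⟨3, by norm_num, fun ε hε => ?_⟩
  obtain ⟨N, hN⟩ := exists_nat_ge (16 / ε)
  refine ⟨max N (2 * (m + 2)), fun n hn hdvd => ?_⟩
  obtain ⟨k, rfl⟩ := hdvd
  have hk : 2 ≤ k := by
    have h := (le_max_right _ _).trans hn
    rw [mul_comm] at h
    exact Nat.le_of_mul_le_mul_left h (by omega)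
  have hm : 0 < m := by omega
  have hcard : Fintype.card (NecklaceVertex k m) = (m + 1 + 1) * k := by
    simp
    ring
  let e : Fin ((m + 1 + 1) * k) ≃ NecklaceVertex k m := (Fintype.equivFinOfCardEq hcard).symm
  have hconn : ((necklace k m).comap e).Connected :=
    (SimpleGraph.Iso.comap e _).connected_iff.mpr (necklace_connected (by omega) hm)
  refine ⟨(necklace k m).comap e, hconn, fun v => ?_, ?_, ?_, ?_⟩
  · rw [ncard_neighborSet_comap]
    exact necklace_le_ncard_neighborSet _
  · refine ⟨e.symm (⟨0, by omega⟩, .inr ⟨0, hm⟩), ?_⟩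
    rw [ncard_neighborSet_comap, e.apply_symm_apply]
    exact necklace_ncard_neighborSet_middle _ _
  · have : Nonempty (Fin ((m + 1 + 1) * k)) := hconn.nonempty
    have hdist := hconn.le_add_dist (necklaceHeight k m ∘ e)
      (fun u v h => necklaceHeight_le_of_adj _ _ h)
      (e.symm (⟨0, by omega⟩, .inr ⟨0, hm⟩)) (e.symm (⟨k - 1, by omega⟩, .inr ⟨0, hm⟩))
    have hdiam := SimpleGraph.dist_le_diam (SimpleGraph.connected_iff_ediam_ne_top.mp hconn)
      (u := e.symm (⟨0, by omega⟩, .inr ⟨0, hm⟩))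
      (v := e.symm (⟨k - 1, by omega⟩, .inr ⟨0, hm⟩))
    simp [necklaceHeight] at hdist
    have h : 3 * k ≤ ((necklace k m).comap e).diam + 3 := by omega
    have h' : (3 : ℝ) * k ≤ ((necklace k m).comap e).diam + 3 := by exact_mod_cast h
    have hk3 : 3 * (((m + 1 + 1) * k : ℕ) : ℝ) / (((m + 1 : ℕ) : ℝ) + 1) = 3 * k := by
      push_cast
      field_simp
    rw [hk3]
    linarith
  · have hsq := sum_cosProfile_sq hk m
    have hk0 : (0 : ℝ) < k := by exact_mod_cast (by omega : 0 < k)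
    have hm1 : (1 : ℝ) ≤ m := by exact_mod_cast hm
    have hN' : (16 : ℝ) ≤ ε * ((m + 2) * k) := by
      have h : (N : ℝ) ≤ (((m + 1 + 1) * k : ℕ) : ℝ) := by
        exact_mod_cast (le_max_left _ _).trans hn
      have h' := hN.trans h
      rw [div_le_iff₀ hε] at h'
      push_cast at h'
      linarith
    refine (algConn_comap_le_rayleigh e (necklace k m) _ ?_ (sum_cosProfile_eq_zero k m)).trans ?_
    · rw [hsq]
      positivity
    · rw [hsq]
      refine (div_le_div_of_nonneg_right (lapQ_cosProfile_le hk m) (by positivity)).trans ?_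
      have hlhs : (Real.pi / k) ^ 2 * (k * m / (2 * (m + 2)) + 8 / ((m : ℝ) + 2) ^ 2) /
          (k * (m + 2) / 2) =
          (m + 16 / ((m + 2) * k)) * (Real.pi ^ 2 / ((m + 2) * k) ^ 2) := by
        field_simp
        ring
      have hrhs : (1 + ε) * (((m + 1 : ℕ) : ℝ) - 1) * Real.pi ^ 2 /
          (((m + 1 + 1) * k : ℕ) : ℝ) ^ 2 =
          (m + ε * m) * (Real.pi ^ 2 / ((m + 2) * k) ^ 2) := by
        push_cast
        ring
      rw [hlhs, hrhs]
      refine mul_le_mul_of_nonneg_right (add_le_add le_rfl ?_) (by positivity)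
      rw [div_le_iff₀ (by positivity)]
      nlinarith [mul_le_mul_of_nonneg_right hm1 (by positivity : 0 ≤ ε * (((m : ℝ) + 2) * k))]
end
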